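/- Let k be a positive integer and let J' be a finite undirected graph on node set V' that is k-outconnected from a node s ∈ V', and let R be the set of neighbors of s in J'. Let 𝒮_{J'} be the family of bisets Ŝ on V' with S ≠ ∅, S⁺ ≠ V', and |δ_{J'}(Ŝ)| < k − |Γ(Ŝ)|. Then every Ŝ ∈ 𝒮_{J'} satisfies s ∈ Γ(Ŝ) and |S ∩ R| ≥ 2; consequently, the maximum number ν of pairwise strongly disjoint bisets in 𝒮_{J'} satisfies ν ≤ ⌊|R|/2⌋. -/

import Mathlib

noncomputable section

attribute [local instance] Classical.propDecidable

/-- A biset on `V`: an ordered pair of finsets `inner ⊆ outer`. -/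
structure Biset (V : Type*) where
  inner : Finset V
  outer : Finset V
  subset : inner ⊆ outer

namespace Biset

variable {V : Type*} [DecidableEq V]

instance [Fintype V] : Fintype (Biset V) :=
  Fintype.ofInjective (fun A => (A.inner, A.outer))
    (fun A B h => by
      cases A; cases B
      simp only [Prod.mk.injEq] at h
      cases h.1; cases h.2; rfl)

/-- The boundary `Γ(Ŝ) = S⁺ ∖ S`. -/
def boundary (A : Biset V) : Finset V := A.outer \ A.inner

def inter (A B : Biset V) : Biset V :=
  ⟨A.inner ∩ B.inner, A.outer ∩ B.outer, Finset.inter_subset_inter A.subset B.subset⟩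

def union (A B : Biset V) : Biset V :=
  ⟨A.inner ∪ B.inner, A.outer ∪ B.outer, Finset.union_subset_union A.subset B.subset⟩

def diff (A B : Biset V) : Biset V :=
  ⟨A.inner \ B.outer, A.outer \ B.inner, Finset.sdiff_subset_sdiff A.subset B.subset⟩

/-- Biset containment: `X̂ ⊆ Ŷ` iff `X ⊆ Y` and `X⁺ ⊆ Y⁺`. -/
def Sub (A B : Biset V) : Prop := A.inner ⊆ B.inner ∧ A.outer ⊆ B.outer

def Laminar (L : Finset (Biset V)) : Prop :=
  ∀ A ∈ L, ∀ B ∈ L, Sub A B ∨ Sub B A ∨ A.inner ∩ B.inner = ∅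

def StronglyLaminar (L : Finset (Biset V)) : Prop :=
  ∀ A ∈ L, ∀ B ∈ L, Sub A B ∨ Sub B A ∨
    (A.inner ∩ B.outer = ∅ ∧ B.inner ∩ A.outer = ∅)

def IntersectingSupermodular (f : Biset V → ℤ) : Prop :=
  ∀ A B : Biset V, (A.inner ∩ B.inner).Nonempty →
    f A + f B ≤ f (inter A B) + f (union A B)

def SkewSupermodular (f : Biset V → ℤ) : Prop :=
  ∀ A B : Biset V,
    f A + f B ≤ f (inter A B) + f (union A B) ∨
    f A + f B ≤ f (diff A B) + f (diff B A)

def vertexBiset (v : V) : Biset V := ⟨{v}, {v}, Finset.Subset.refl _⟩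

end Biset

/-- `γ = max { |Γ(Ŝ)| : f(Ŝ) > 0 }` (0 if no such biset exists). -/
def gammaOf {V : Type*} [Fintype V] [DecidableEq V] (f : Biset V → ℤ) : ℕ :=
  (Finset.univ.filter fun A : Biset V => 0 < f A).sup fun A => (Biset.boundary A).card

/-- The leaves (inclusion-minimal members) of a biset family. -/
def leaves {V : Type*} (L : Finset (Biset V)) : Finset (Biset V) :=
  L.filter fun A => ∀ B ∈ L, Biset.Sub B A → B = A

/-- `max_{Ŝ ∈ L} |Γ(Ŝ)|` (0 if `L` is empty). -/
def gammaL {V : Type*} [DecidableEq V] (L : Finset (Biset V)) : ℕ :=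
  L.sup fun A => (Biset.boundary A).card

section OutConn

variable {V : Type*} [Fintype V] [DecidableEq V]

/-- `δ_H(Ŝ)`: edges of `H` covering the biset `Ŝ`
(one end-node in the inner part, the other outside the outer part). -/
def sDelta (H : Finset (Sym2 V)) (A : Biset V) : Finset (Sym2 V) :=
  H.filter fun e => ∃ a b : V, e = s(a, b) ∧ a ∈ A.inner ∧ b ∉ A.outer

/-- `H` is `k`-outconnected from `s`: `|δ_H(Ŝ)| ≥ k − |Γ(Ŝ)|` for every biset `Ŝ`
with nonempty inner part whose outer part avoids `s`. -/
def OutConnected (k : ℕ) (s : V) (H : Finset (Sym2 V)) : Prop :=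
  ∀ A : Biset V, A.inner.Nonempty → s ∉ A.outer →
    (k : ℤ) - ((Biset.boundary A).card : ℤ) ≤ ((sDelta H A).card : ℤ)

/-- The family `𝒮_H` of deficient bisets: `S ≠ ∅`, `S⁺ ≠ V`, and
`|δ_H(Ŝ)| < k − |Γ(Ŝ)|`. -/
def deficient (k : ℕ) (H : Finset (Sym2 V)) : Finset (Biset V) :=
  Finset.univ.filter fun A : Biset V =>
    A.inner.Nonempty ∧ A.outer ≠ Finset.univ ∧
      ((sDelta H A).card : ℤ) < (k : ℤ) - ((Biset.boundary A).card : ℤ)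

/-- Two bisets are strongly disjoint if `X∩Y⁺ = ∅` and `Y∩X⁺ = ∅`. -/
def StronglyDisjoint (A B : Biset V) : Prop :=
  A.inner ∩ B.outer = ∅ ∧ B.inner ∩ A.outer = ∅

/-- The maximum number of pairwise strongly disjoint bisets in `F`. -/
def nuOf (F : Finset (Biset V)) : ℕ :=
  (F.powerset.filter fun D =>
    ∀ A ∈ D, ∀ B ∈ D, A ≠ B → StronglyDisjoint A B).sup Finset.card

end OutConn

section OutConn

variable {V : Type*} [Fintype V] [DecidableEq V]

/-- The complementary biset `(V ∖ S⁺, V ∖ S)`. -/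
def Biset.compl (A : Biset V) : Biset V :=
  ⟨A.outerᶜ, A.innerᶜ, Finset.compl_subset_compl.2 A.subset⟩

theorem Biset.boundary_compl (A : Biset V) : A.compl.boundary = A.boundary := by
  ext v
  simp [Biset.boundary, Biset.compl, and_comm]

theorem sDelta_compl (H : Finset (Sym2 V)) (A : Biset V) : sDelta H A.compl = sDelta H A := by
  ext e
  simp only [sDelta, Biset.compl, Finset.mem_filter, Finset.mem_compl, not_not]
  refine and_congr_right fun _ => ⟨?_, ?_⟩ <;>
  · rintro ⟨a, b, rfl, ha, hb⟩
    exact ⟨b, a, Sym2.eq_swap, hb, ha⟩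

/-- The biset obtained by deleting the node `s` from the inner and the outer part. -/
def Biset.erase (A : Biset V) (s : V) : Biset V :=
  ⟨A.inner.erase s, A.outer.erase s, Finset.erase_subset_erase s A.subset⟩

theorem Biset.boundary_erase {V : Type*} [DecidableEq V] (A : Biset V) (s : V) :
    (A.erase s).boundary = A.boundary.erase s := by
  ext v
  simp only [Biset.boundary, Biset.erase, Finset.mem_sdiff, Finset.mem_erase]
  tauto

theorem card_sDelta_erase_le (H : Finset (Sym2 V)) (A : Biset V) (s : V) :
    (sDelta H (A.erase s)).card ≤ (sDelta H A).card +
      (A.inner ∩ Finset.univ.filter fun v => v ≠ s ∧ s(s, v) ∈ H).card := by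
  have hsub : sDelta H (A.erase s) ⊆ sDelta H A ∪
      (A.inner ∩ Finset.univ.filter fun v => v ≠ s ∧ s(s, v) ∈ H).image fun v => s(s, v) := by
    intro e he
    simp only [sDelta, Biset.erase, Finset.mem_filter, Finset.mem_erase] at he
    obtain ⟨heH, a, b, rfl, ⟨has, ha⟩, hb⟩ := he
    rw [Finset.mem_union]
    by_cases hbs : b = s
    · subst hbs
      right
      rw [Finset.mem_image]
      refine ⟨a, ?_, Sym2.eq_swap⟩
      rw [Sym2.eq_swap] at heH
      simp [ha, has, heH]
    · left
      exact Finset.mem_filter.2 ⟨heH, a, b, rfl, ha, fun h => hb ⟨hbs, h⟩⟩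
  exact (Finset.card_le_card hsub).trans
    ((Finset.card_union_le _ _).trans (Nat.add_le_add_left Finset.card_image_le _))

theorem OutConnected.mem_boundary_of_mem_deficient {k : ℕ} {s : V} {H : Finset (Sym2 V)}
    (hout : OutConnected k s H) {A : Biset V} (hA : A ∈ deficient k H) : s ∈ A.boundary := by
  obtain ⟨-, hne, hout', hdef⟩ := Finset.mem_filter.1 hA
  refine Finset.mem_sdiff.2 ⟨?_, fun hs => ?_⟩
  · by_contra hs
    exact absurd (hout A hne hs) (not_le.2 hdef)
  · have h := hout A.compl
      (Finset.nonempty_iff_ne_empty.2 (mt (Finset.compl_eq_empty_iff _).1 hout'))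
      (fun h => Finset.mem_compl.1 h hs)
    rw [Biset.boundary_compl, sDelta_compl] at h
    exact absurd h (not_le.2 hdef)

theorem OutConnected.two_le_card_inner_inter_neighbors {k : ℕ} {s : V} {H : Finset (Sym2 V)}
    (hout : OutConnected k s H) {A : Biset V} (hA : A ∈ deficient k H) :
    2 ≤ (A.inner ∩ Finset.univ.filter fun v => v ≠ s ∧ s(s, v) ∈ H).card := by
  have hs := hout.mem_boundary_of_mem_deficient hA
  obtain ⟨-, hne, -, hdef⟩ := Finset.mem_filter.1 hA
  have hinner : (A.erase s).inner = A.inner :=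
    Finset.erase_eq_of_notMem (Finset.mem_sdiff.1 hs).2
  have h := hout (A.erase s) (hinner ▸ hne) (Finset.notMem_erase _ _)
  rw [Biset.boundary_erase] at h
  have hcard := Finset.card_erase_add_one hs
  have hle := card_sDelta_erase_le H A s
  omega

theorem nuOf_le_card_div {F : Finset (Biset V)} {R : Finset V} {m : ℕ} (hm : 0 < m)
    (hF : ∀ A ∈ F, m ≤ (A.inner ∩ R).card) : nuOf F ≤ R.card / m := by
  refine Finset.sup_le fun D hD => ?_
  obtain ⟨hDF, hdisj⟩ := Finset.mem_filter.1 hD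
  rw [Finset.mem_powerset] at hDF
  rw [Nat.le_div_iff_mul_le hm]
  have hpair : (D : Set (Biset V)).PairwiseDisjoint fun A => A.inner ∩ R := by
    intro A hA B hB hAB
    refine Finset.disjoint_left.2 fun v hvA hvB => ?_
    exact Finset.notMem_empty v <| (hdisj A hA B hB hAB).1 ▸ Finset.mem_inter.2
      ⟨(Finset.mem_inter.1 hvA).1, B.subset (Finset.mem_inter.1 hvB).1⟩
  calc D.card * m ≤ ∑ A ∈ D, (A.inner ∩ R).card := by
        simpa using Finset.card_nsmul_le_sum D _ m fun A hA => hF A (hDF hA)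
    _ = (D.biUnion fun A => A.inner ∩ R).card := (Finset.card_biUnion hpair).symm
    _ ≤ R.card := Finset.card_le_card <|
        Finset.biUnion_subset.2 fun _ _ => Finset.inter_subset_right

end OutConn

theorem stmt_18 {V' : Type*} [Fintype V'] [DecidableEq V']
    (k : ℕ) (hk : 1 ≤ k) (J' : Finset (Sym2 V')) (s : V')
    (hout : OutConnected k s J')
    (R : Finset V') (hR : R = Finset.univ.filter fun v => v ≠ s ∧ s(s, v) ∈ J') :
    (∀ A ∈ deficient k J', s ∈ Biset.boundary A ∧ 2 ≤ (A.inner ∩ R).card) ∧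
    nuOf (deficient k J') ≤ R.card / 2 := by
  subst hR
  exact ⟨fun A hA => ⟨hout.mem_boundary_of_mem_deficient hA,
      hout.two_le_card_inner_inter_neighbors hA⟩,
    nuOf_le_card_div two_pos fun A hA => hout.two_le_card_inner_inter_neighbors hA⟩
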